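/- Fix a polynomial initial value problem over variables S = {x_1,…,x_n}, a partition G of S, and ε ≥ 0. Define the refinement operator F on partitions of S by F(H) = S/(∼^{B*}_{H,ε} ∩ ∼_H). Then for the iteration H_0 = G, H_{k+1} = F(H_k): each H_{k+1} refines H_k; the sequence stabilizes after at most n iterations, i.e., there exists k ≤ n with F(H_k) = H_k; and the first such fixed point H_k is the unique coarsest ε-BDE partition of S refining G. -/

import Mathlib

open MvPolynomial

noncomputable section

/-- The sum of the absolute values of the coefficients of a multivariate polynomial
(in normal form, where each monomial appears at most once). -/
def coeffAbsSum {σ : Type*} (p : MvPolynomial σ ℝ) : ℝ :=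
  ∑ α ∈ p.support, |coeff α p|

/-- The representative variable of the block of `i` in the partition `s`. -/
def ptrep {n : ℕ} (s : Setoid (Fin n)) (i : Fin n) : Fin n :=
  (Quotient.mk s i).out

/-- `x_i ∼^B_{H,ε} x_j` : the coefficients of the substituted difference polynomial
`π_H (q_i - q_j)` sum up, in absolute value, to at most `ε`. -/
def simB {n : ℕ} (q : Fin n → MvPolynomial (Fin n) ℝ) (s : Setoid (Fin n)) (ε : ℝ)
    (i j : Fin n) : Prop :=
  coeffAbsSum (rename (ptrep s) (q i - q j)) ≤ ε

/-- `s` refines `t` : every block of `s` is contained in some block of `t`. -/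
def Refines {n : ℕ} (s t : Setoid (Fin n)) : Prop :=
  ∀ i j : Fin n, s.r i j → t.r i j

/-- `s` is an `ε`-BDE partition : `s = S / (∼^{B*}_{s,ε} ∩ ∼_s)`, where `∼^{B*}_{s,ε}` is the
transitive closure of `∼^B_{s,ε}` and `∼_s` is the equivalence relation induced by `s`. -/
def IsEpsBDE {n : ℕ} (q : Fin n → MvPolynomial (Fin n) ℝ) (s : Setoid (Fin n)) (ε : ℝ) : Prop :=
  ∀ i j : Fin n, s.r i j ↔ (Relation.TransGen (simB q s ε) i j ∧ s.r i j)

theorem coeffAbsSum_neg {σ : Type*} (p : MvPolynomial σ ℝ) :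
    coeffAbsSum (-p) = coeffAbsSum p := by
  simp [coeffAbsSum]

theorem simB_refl {n : ℕ} (q : Fin n → MvPolynomial (Fin n) ℝ) (s : Setoid (Fin n)) {ε : ℝ}
    (hε : 0 ≤ ε) (i : Fin n) : simB q s ε i i := by
  simpa [simB, coeffAbsSum] using hε

theorem simB_symm {n : ℕ} (q : Fin n → MvPolynomial (Fin n) ℝ) (s : Setoid (Fin n)) {ε : ℝ} :
    Symmetric (simB q s ε) := by
  intro i j h
  have h2 : rename (ptrep s) (q j - q i) = -rename (ptrep s) (q i - q j) := by
    rw [← map_neg, neg_sub]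
  unfold simB at h ⊢
  rw [h2, coeffAbsSum_neg]
  exact h

theorem transGen_symmetric {α : Type*} {r : α → α → Prop} (h : Symmetric r) :
    Symmetric (Relation.TransGen r) := by
  intro a b hab
  induction hab with
  | single h1 => exact Relation.TransGen.single (h h1)
  | tail _ h1 ih => exact Relation.TransGen.head (h h1) ih

/-- The refinement operator `F(H) = S / (∼^{B*}_{H,ε} ∩ ∼_H)`. -/
def refineB {n : ℕ} (q : Fin n → MvPolynomial (Fin n) ℝ) (ε : ℝ) (hε : 0 ≤ ε)
    (H : Setoid (Fin n)) : Setoid (Fin n) where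
  r i j := Relation.TransGen (simB q H ε) i j ∧ H.r i j
  iseqv := by
    refine ⟨fun i => ⟨Relation.TransGen.single (simB_refl q H hε i), H.iseqv.refl i⟩, ?_, ?_⟩
    · rintro i j ⟨h1, h2⟩
      exact ⟨transGen_symmetric (simB_symm q H) h1, H.iseqv.symm h2⟩
    · rintro i j k ⟨h1, h2⟩ ⟨h3, h4⟩
      exact ⟨h1.trans h3, H.iseqv.trans h2 h4⟩

theorem coeffAbsSum_eq_sum_of_subset {σ : Type*} (p : MvPolynomial σ ℝ) {T : Finset (σ →₀ ℕ)}
    (hT : p.support ⊆ T) : coeffAbsSum p = ∑ α ∈ T, |coeff α p| := by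
  refine Finset.sum_subset hT fun α _ hα => ?_
  rw [notMem_support_iff.mp hα, abs_zero]

theorem coeffAbsSum_add_le {σ : Type*} (p q : MvPolynomial σ ℝ) :
    coeffAbsSum (p + q) ≤ coeffAbsSum p + coeffAbsSum q := by
  classical
  rw [coeffAbsSum_eq_sum_of_subset (p + q) support_add,
    coeffAbsSum_eq_sum_of_subset p Finset.subset_union_left,
    coeffAbsSum_eq_sum_of_subset q Finset.subset_union_right, ← Finset.sum_add_distrib]
  refine Finset.sum_le_sum fun α _ => ?_
  rw [coeff_add]
  exact abs_add_le _ _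

theorem coeffAbsSum_monomial {σ : Type*} (α : σ →₀ ℕ) (c : ℝ) :
    coeffAbsSum (monomial α c) = |c| := by
  classical
  rw [coeffAbsSum_eq_sum_of_subset _ support_monomial_subset]
  simp

theorem coeffAbsSum_sum_le {σ ι : Type*} (T : Finset ι) (f : ι → MvPolynomial σ ℝ) :
    coeffAbsSum (∑ i ∈ T, f i) ≤ ∑ i ∈ T, coeffAbsSum (f i) :=
  Finset.le_sum_of_subadditive coeffAbsSum (by simp [coeffAbsSum]) coeffAbsSum_add_le T f

theorem coeffAbsSum_rename_le {σ τ : Type*} (f : σ → τ) (p : MvPolynomial σ ℝ) :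
    coeffAbsSum (rename f p) ≤ coeffAbsSum p := by
  conv_lhs => rw [p.as_sum, map_sum]
  refine (coeffAbsSum_sum_le _ _).trans_eq ?_
  simp only [rename_monomial, coeffAbsSum_monomial]
  rfl

theorem Refines.ptrep_comp_ptrep {n : ℕ} {s t : Setoid (Fin n)} (h : Refines s t) :
    ptrep t ∘ ptrep s = ptrep t := by
  funext i
  exact congrArg Quotient.out (Quotient.sound (h _ _ (Quotient.mk_out (s := s) i)))

theorem Refines.simB {n : ℕ} {q : Fin n → MvPolynomial (Fin n) ℝ} {s t : Setoid (Fin n)}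
    (h : Refines s t) {ε : ℝ} {i j : Fin n} (hij : simB q s ε i j) : simB q t ε i j := by
  unfold _root_.simB at hij ⊢
  rw [← h.ptrep_comp_ptrep, ← rename_rename]
  exact (coeffAbsSum_rename_le _ _).trans hij

theorem Refines.antisymm {n : ℕ} {s t : Setoid (Fin n)} (h : Refines s t) (h' : Refines t s) :
    s = t :=
  Setoid.ext fun i j => ⟨h i j, h' i j⟩

theorem refineB_refines {n : ℕ} (q : Fin n → MvPolynomial (Fin n) ℝ) {ε : ℝ} (hε : 0 ≤ ε)
    (H : Setoid (Fin n)) : Refines (refineB q ε hε H) H :=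
  fun _ _ h => h.2

theorem isEpsBDE_of_refineB_eq {n : ℕ} {q : Fin n → MvPolynomial (Fin n) ℝ} {ε : ℝ} {hε : 0 ≤ ε}
    {H : Setoid (Fin n)} (h : refineB q ε hε H = H) : IsEpsBDE q H ε := by
  refine fun i j => ⟨fun hij => ?_, And.right⟩
  rw [← h] at hij
  exact hij

theorem IsEpsBDE.refines_refineB {n : ℕ} {q : Fin n → MvPolynomial (Fin n) ℝ} {ε : ℝ}
    (hε : 0 ≤ ε) {H' H : Setoid (Fin n)} (h' : IsEpsBDE q H' ε) (h : Refines H' H) :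
    Refines H' (refineB q ε hε H) :=
  fun i j hij => ⟨Relation.TransGen.mono (fun _ _ => h.simB) _ _ ((h' i j).mp hij).1, h i j hij⟩

theorem Refines.card_quotient_lt {n : ℕ} {s t : Setoid (Fin n)} (h : Refines s t) (hne : s ≠ t) :
    Nat.card (Quotient t) < Nat.card (Quotient s) := by
  let f : Quotient s → Quotient t := Quotient.map' id h
  have hf : Function.Surjective f := by
    rintro ⟨i⟩
    exact ⟨Quotient.mk s i, rfl⟩
  refine lt_of_le_of_ne (Nat.card_le_card_of_surjective f hf) fun hcard => hne ?_
  have hinj := (hf.bijective_of_nat_card_le hcard.ge).injective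
  refine h.antisymm fun i j hij => ?_
  have hmk : f (Quotient.mk s i) = f (Quotient.mk s j) := Quotient.sound (s := t) hij
  exact Quotient.exact (hinj hmk)

theorem exists_le_refineB_eq {n : ℕ} (q : Fin n → MvPolynomial (Fin n) ℝ) {ε : ℝ} (hε : 0 ≤ ε)
    {Hseq : ℕ → Setoid (Fin n)} (hstep : ∀ k, Hseq (k + 1) = refineB q ε hε (Hseq k)) :
    ∃ k, k ≤ n ∧ refineB q ε hε (Hseq k) = Hseq k := by
  by_contra! hne
  have hcard : ∀ k, k ≤ n + 1 → k ≤ Nat.card (Quotient (Hseq k)) := by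
    intro k
    induction k with
    | zero => exact fun _ => Nat.zero_le _
    | succ k ih =>
      intro hk
      have hlt := (refineB_refines q hε (Hseq k)).card_quotient_lt (hne k (by omega))
      rw [← hstep] at hlt
      have := ih (by omega)
      omega
  have hle : Nat.card (Quotient (Hseq (n + 1))) ≤ Nat.card (Fin n) :=
    Nat.card_le_card_of_surjective (Quotient.mk _) Quotient.mk_surjective
  have := hcard (n + 1) le_rfl
  rw [Nat.card_fin] at hle
  omega

/-- for the partition-refinement iteration `H_0 = G`, `H_{k+1} = F(H_k)`
driven by the operator `F = refineB q ε hε`: every `H_{k+1}` refines `H_k`; the iteration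
stabilizes after at most `n` steps; and the first fixed point is the unique coarsest
`ε`-BDE partition refining `G`. -/
theorem refineB_iteration {n : ℕ} (q : Fin n → MvPolynomial (Fin n) ℝ) (σ0 : Fin n → ℝ)
    (G : Setoid (Fin n)) (ε : ℝ) (hε : 0 ≤ ε)
    (Hseq : ℕ → Setoid (Fin n)) (h0 : Hseq 0 = G)
    (hstep : ∀ k, Hseq (k + 1) = refineB q ε hε (Hseq k)) :
    (∀ k, Refines (Hseq (k + 1)) (Hseq k)) ∧
    (∃ k, k ≤ n ∧ refineB q ε hε (Hseq k) = Hseq k) ∧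
    (∀ k, refineB q ε hε (Hseq k) = Hseq k →
      (∀ l, l < k → refineB q ε hε (Hseq l) ≠ Hseq l) →
      (IsEpsBDE q (Hseq k) ε ∧ Refines (Hseq k) G ∧
        (∀ H' : Setoid (Fin n), IsEpsBDE q H' ε → Refines H' G → Refines H' (Hseq k)) ∧
        (∀ H'' : Setoid (Fin n), IsEpsBDE q H'' ε → Refines H'' G →
          (∀ H' : Setoid (Fin n), IsEpsBDE q H' ε → Refines H' G → Refines H' H'') →
          H'' = Hseq k))) := by
  have hdec : ∀ k, Refines (Hseq (k + 1)) (Hseq k) := fun k => by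
    rw [hstep]
    exact refineB_refines q hε _
  have hG : ∀ k, Refines (Hseq k) G := by
    intro k
    induction k with
    | zero => exact h0 ▸ fun _ _ h => h
    | succ k ih => exact fun i j h => ih i j (hdec k i j h)
  have hcoarse : ∀ H', IsEpsBDE q H' ε → Refines H' G → ∀ k, Refines H' (Hseq k) := by
    intro H' hBDE href k
    induction k with
    | zero => exact h0 ▸ href
    | succ k ih =>
      rw [hstep]
      exact hBDE.refines_refineB hε ih
  refine ⟨hdec, exists_le_refineB_eq q hε hstep, fun k hk _ => ?_⟩
  have hBDE := isEpsBDE_of_refineB_eq hk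
  exact ⟨hBDE, hG k, fun H' h1 h2 => hcoarse H' h1 h2 k, fun H'' h1 h2 h3 =>
    (hcoarse H'' h1 h2 k).antisymm (h3 _ hBDE (hG k))⟩
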